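/- Let J₉ : ℝ² → ℝ be defined by J₉(x,y) = −1 + 2·Re(j₉(x+iy, x−iy)) where j₉(u,v) = (9−27b)u³ − 9b·u⁶ − b·u⁹ + (27/2)uv − (9−54b)u⁴v + 9b·u⁷v − 27u²v² − 27b·u⁵v² + 15u³v³ and b = exp(−iπ/3). Then J₉ has exactly 64 critical points in ℝ²; at every critical point the value of J₉ is 0, −1, or 8; exactly 36 critical points have value 0, exactly 19 have value −1, and exactly 9 have value 8. -/

import Mathlib

noncomputable section

/-- `bC = exp(-iπ/3)`. -/
def bC : ℂ := Complex.exp (-((Real.pi : ℂ) / 3) * Complex.I)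

/-- The polynomial `j9(u,v)`. -/
def j9 (u v : ℂ) : ℂ := (9 - 27*bC)*u^3 - 9*bC*u^6 - bC*u^9 + (27/2)*u*v - (9 - 54*bC)*u^4*v + 9*bC*u^7*v - 27*u^2*v^2 - 27*bC*u^5*v^2 + 15*u^3*v^3

/-- The real folding-type polynomial `J9(x,y) = -1 + 2 Re(j9(x+iy, x-iy))`, as a
function on `ℝ × ℝ`. -/
def J9 : ℝ × ℝ → ℝ := fun p =>
  -1 + 2 * (j9 ((p.1 : ℂ) + (p.2 : ℂ) * Complex.I) ((p.1 : ℂ) - (p.2 : ℂ) * Complex.I)).re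

/-- Partial derivative in the first variable. -/
def pdx (f : ℝ × ℝ → ℝ) (p : ℝ × ℝ) : ℝ := deriv (fun t => f (t, p.2)) p.1

/-- Partial derivative in the second variable. -/
def pdy (f : ℝ × ℝ → ℝ) (p : ℝ × ℝ) : ℝ := deriv (fun t => f (p.1, t)) p.2

/-- Determinant of the Hessian matrix of `f` at `p`. -/
def hessDet2 (f : ℝ × ℝ → ℝ) (p : ℝ × ℝ) : ℝ :=
  pdx (pdx f) p * pdy (pdy f) p - pdx (pdy f) p * pdy (pdx f) p

/-! ### The power sum `p9` in terms of elementary symmetric functions, and its partials -/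

def p9 (u v : ℂ) : ℂ := u^9 - 9*u^7*v + 27*u^5*v^2 - 30*u^3*v^3 + 9*u*v^4 + 9*u^6 - 45*u^4*v
  + 54*u^2*v^2 - 9*v^3 + 18*u^3 - 27*u*v + 3

def p9u (u v : ℂ) : ℂ := 9*u^8 - 63*u^6*v + 135*u^4*v^2 - 90*u^2*v^3 + 9*v^4 + 54*u^5 - 180*u^3*v
  + 108*u*v^2 + 54*u^2 - 27*v

def p9v (u v : ℂ) : ℂ := -9*u^7 + 54*u^5*v - 90*u^3*v^2 + 36*u*v^3 - 45*u^4
  + 108*u^2*v - 27*v^2 - 27*u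

def h8 (x y : ℂ) : ℂ := x^8 + x^7*y + x^6*y^2 + x^5*y^3 + x^4*y^4 + x^3*y^5 + x^2*y^6 + x*y^7 + y^8

lemma h8_mul (x y : ℂ) : (x - y) * h8 x y = x^9 - y^9 := by unfold h8; ring

lemma p9_hom (x y c : ℂ) : ∀ u v e : ℂ, u = x + y + c → v = x*y + x*c + y*c → e = x*y*c →
    x^9 + y^9 + c^9 = u^9 - 9*u^7*v + 27*u^5*v^2 - 30*u^3*v^3 + 9*u*v^4 + 9*u^6*e - 45*u^4*v*e
      + 54*u^2*v^2*e - 9*v^3*e + 18*u^3*e^2 - 27*u*v*e^2 + 3*e^3 := by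
  rintro u v e rfl rfl rfl; ring

lemma p9_sum (x y c : ℂ) (h : x*y*c = 1) :
    p9 (x+y+c) (x*y+x*c+y*c) = x^9 + y^9 + c^9 := by
  rw [p9_hom x y c _ _ 1 rfl rfl h.symm]; unfold p9; ring

lemma p9d_hom (x y c : ℂ) : ∀ u v e : ℂ, u = x + y + c → v = x*y + x*c + y*c → e = x*y*c →
    9 * h8 x y = (9*u^8 - 63*u^6*v + 135*u^4*v^2 - 90*u^2*v^3 + 9*v^4 + 54*u^5*e - 180*u^3*v*e
  + 108*u*v^2*e + 54*u^2*e^2 - 27*v*e^2) + c * (-9*u^7 + 54*u^5*v - 90*u^3*v^2 + 36*u*v^3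
  - 45*u^4*e + 108*u^2*v*e - 27*v^2*e - 27*u*e^2) := by
  rintro u v e rfl rfl rfl; unfold h8; ring

lemma p9d_sum (x y c : ℂ) (h : x*y*c = 1) :
    p9u (x+y+c) (x*y+x*c+y*c) + c * p9v (x+y+c) (x*y+x*c+y*c) = 9 * h8 x y := by
  rw [p9d_hom x y c _ _ 1 rfl rfl h.symm]; unfold p9u p9v; ring

lemma p9d_sum_swap (x y c : ℂ) (h : x*y*c = 1) :
    p9v (x*y+x*c+y*c) (x+y+c) + c * p9u (x*y+x*c+y*c) (x+y+c) = 9 * h8 x y * c^9 := by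
  have h1 := p9d_sum (y*c) (x*c) (x*y) (by linear_combination (x*y*c+1)*h)
  have e1 : y*c + x*c + x*y = x*y+x*c+y*c := by ring
  have e2 : y*c*(x*c) + y*c*(x*y) + x*c*(x*y) = x + y + c := by linear_combination (x+y+c)*h
  rw [e1, e2] at h1
  have h2 : c * h8 (y*c) (x*c) = h8 x y * c^9 := by unfold h8; ring
  linear_combination c * h1 + 9 * h2 - p9v (x*y+x*c+y*c) (x+y+c) * h

/-! ### The constant `b` -/

def zt : ℂ := Complex.exp (2 * Real.pi * Complex.I / (54 : ℕ))

lemma zt_prim : IsPrimitiveRoot zt 54 := Complex.isPrimitiveRoot_exp 54 (by norm_num)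

lemma zt_pow_eq (m n : ℕ) : zt ^ m = zt ^ n ↔ m % 54 = n % 54 := by
  have hf : IsOfFinOrder zt := zt_prim.isOfFinOrder (by norm_num)
  rw [hf.pow_eq_pow_iff_modEq, ← zt_prim.eq_orderOf]; rfl

lemma bC_eq : bC = zt ^ 45 := by
  rw [zt, ← Complex.exp_nat_mul, bC, Complex.exp_eq_exp_iff_exists_int]
  exact ⟨-1, by push_cast; ring⟩

lemma conj_zt_mul (a : ℕ) : (starRingEnd ℂ) (zt ^ a) * zt ^ a = 1 := by
  have h : ‖zt ^ a‖ = 1 := by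
    rw [norm_pow, zt_prim.norm'_eq_one (by norm_num), one_pow]
  rw [Complex.conj_mul', h]; simp

def bb : ℂ := zt ^ 9

lemma bC_mul : bC * bb = 1 := by
  rw [bC_eq, bb, ← pow_add]; exact zt_prim.pow_eq_one

lemma conj_bC : (starRingEnd ℂ) bC = bb := by
  have h := conj_zt_mul 45
  rw [← bC_eq] at h
  linear_combination bb * h - (starRingEnd ℂ) bC * bC_mul

lemma bC_re : bC.re = 1/2 := by
  have : -((Real.pi : ℂ) / 3) * Complex.I = ((-(Real.pi/3) : ℝ) : ℂ) * Complex.I := by push_cast; ring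
  rw [bC, this, Complex.exp_ofReal_mul_I_re, Real.cos_neg, Real.cos_pi_div_three]

lemma bC_add : bC + bb = 1 := by
  rw [← conj_bC, Complex.add_conj, bC_re]; norm_num

/-! ### Reduction of criticality -/

def Gu (u v : ℂ) : ℂ := -(bC * p9u u v + bb * p9v v u)

def dju (u v : ℂ) : ℂ := 3*(9 - 27*bC)*u^2 - 54*bC*u^5 - 9*bC*u^8 + (27/2)*v - 4*(9 - 54*bC)*u^3*v
  + 63*bC*u^6*v - 54*u*v^2 - 135*bC*u^4*v^2 + 45*u^2*v^3

def djv (u v : ℂ) : ℂ := (27/2)*u - (9 - 54*bC)*u^4 + 9*bC*u^7 - 54*u^2*v - 54*bC*u^5*v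
  + 45*u^3*v^2

lemma Gu_eq (u v : ℂ) (h : v = (starRingEnd ℂ) u) : dju u v + (starRingEnd ℂ) (djv u v) = Gu u v := by
  have hvu : (starRingEnd ℂ) v = u := by rw [h]; simp
  unfold dju djv Gu p9u p9v
  simp only [map_add, map_sub, map_mul, map_pow, hvu, ← h, conj_bC, map_div₀, map_ofNat]
  have hb : bb = 1 - bC := by linear_combination bC_add
  rw [hb]; ring

lemma J9_eq (p : ℝ × ℝ) (u v : ℂ) (hu : u = (p.1 : ℂ) + (p.2 : ℂ) * Complex.I)
    (hv : v = (starRingEnd ℂ) u) : (J9 p : ℂ) = 2 - (bC * p9 u v + bb * p9 v u) := by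
  have hvu : (starRingEnd ℂ) v = u := by rw [hv]; simp
  have e : (p.1 : ℂ) - (p.2 : ℂ) * Complex.I = v := by
    rw [hv, hu]; simp; ring
  have : (J9 p : ℂ) = -1 + (j9 u v + (starRingEnd ℂ) (j9 u v)) := by
    rw [Complex.add_conj]
    simp only [J9]; rw [e, ← hu]; push_cast; ring
  rw [this]
  unfold j9 p9
  simp only [map_add, map_sub, map_mul, map_pow, hvu, ← hv, conj_bC, map_div₀, map_ofNat]
  have hb : bb = 1 - bC := by linear_combination bC_add
  rw [hb]; ring

lemma j9_hasDeriv (f g : ℝ → ℂ) (df dg : ℂ) (t : ℝ) (hf : HasDerivAt f df t)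
    (hg : HasDerivAt g dg t) :
    HasDerivAt (fun s => -1 + 2 * (j9 (f s) (g s)).re)
      (2 * (dju (f t) (g t) * df + djv (f t) (g t) * dg).re) t := by
  have h : HasDerivAt (fun s => j9 (f s) (g s)) (dju (f t) (g t) * df + djv (f t) (g t) * dg) t := by
    unfold j9
    have H := (((((((((hf.pow 3).const_mul (9 - 27*bC)).sub ((hf.pow 6).const_mul (9*bC))).sub
      ((hf.pow 9).const_mul bC)).add ((hf.const_mul (27/2)).mul hg)).sub
      (((hf.pow 4).const_mul (9 - 54*bC)).mul hg)).add
      (((hf.pow 7).const_mul (9*bC)).mul hg)).sub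
      (((hf.pow 2).const_mul 27).mul (hg.pow 2))).sub
      (((hf.pow 5).const_mul (27*bC)).mul (hg.pow 2))).add
      (((hf.pow 3).const_mul 15).mul (hg.pow 3))
    refine H.congr_deriv ?_
    simp only [Pi.pow_apply]
    unfold dju djv
    push_cast
    ring
  have h2 := Complex.reCLM.hasFDerivAt.comp_hasDerivAt t h
  exact (h2.const_mul 2).const_add (-1)

lemma crit_iff_Gu (p : ℝ × ℝ) (u v : ℂ) (hu : u = (p.1 : ℂ) + (p.2 : ℂ) * Complex.I)
    (hv : v = (starRingEnd ℂ) u) : (pdx J9 p = 0 ∧ pdy J9 p = 0) ↔ Gu u v = 0 := by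
  have e : (p.1 : ℂ) - (p.2 : ℂ) * Complex.I = v := by
    rw [hv, hu]; simp; ring
  have hid : ∀ t : ℝ, HasDerivAt (fun s : ℝ => (s : ℂ)) 1 t := fun t => Complex.ofRealCLM.hasDerivAt
  have hx : pdx J9 p = 2 * (dju u v + djv u v).re := by
    have h := j9_hasDeriv (fun s => (s : ℂ) + (p.2 : ℂ) * Complex.I)
      (fun s => (s : ℂ) - (p.2 : ℂ) * Complex.I) 1 1 p.1 ((hid _).add_const _) ((hid _).sub_const _)
    rw [← hu, e, mul_one, mul_one] at h
    exact h.deriv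
  have hy : pdy J9 p = 2 * (dju u v * Complex.I + djv u v * (-Complex.I)).re := by
    have h := j9_hasDeriv (fun s => (p.1 : ℂ) + (s : ℂ) * Complex.I)
      (fun s => (p.1 : ℂ) - (s : ℂ) * Complex.I) (1 * Complex.I) (-(1 * Complex.I)) p.2
      (((hid _).mul_const _).const_add _) (((hid _).mul_const _).const_sub _)
    rw [← hu, e, one_mul] at h
    exact h.deriv
  rw [hx, hy, ← Gu_eq u v hv, Complex.ext_iff]
  simp
  intro _
  constructor <;> intro h <;> linarith

lemma Gu_conj (u v : ℂ) (hv : v = (starRingEnd ℂ) u) :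
    (starRingEnd ℂ) (Gu u v) = -(bC * p9v u v + bb * p9u v u) := by
  have hvu : (starRingEnd ℂ) v = u := by rw [hv]; simp
  have hb : (starRingEnd ℂ) bb = bC := by rw [← conj_bC]; simp
  unfold Gu p9u p9v
  simp only [map_add, map_sub, map_mul, map_pow, map_neg, hvu, ← hv, conj_bC, hb, map_ofNat]
  ring

lemma bb_cube : bb^3 = -1 := by
  have h1 := bC_add
  have h2 := bC_mul
  have : bb^2 = bb - 1 := by linear_combination -h2 + bb * h1
  linear_combination (bb + 1) * this

/-- The factorised gradient. -/
lemma Gu_fact (x y c : ℂ) (h : x*y*c = 1)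
    (hv : x*y+x*c+y*c = (starRingEnd ℂ) (x+y+c)) :
    Gu (x+y+c) (x*y+x*c+y*c) + c * (starRingEnd ℂ) (Gu (x+y+c) (x*y+x*c+y*c))
      = -9 * h8 x y * (bb * (c^9 - bb)) := by
  rw [Gu_conj _ _ hv, Gu]
  have h1 := p9d_sum x y c h
  have h2 := p9d_sum_swap x y c h
  have h3 : bC = -bb^2 := by linear_combination bC * bb_cube - bb^2 * bC_mul
  linear_combination -bC * h1 - bb * h2 - 9 * h8 x y * h3

lemma cond_of_Gu (x y c : ℂ) (h : x*y*c = 1)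
    (hv : x*y+x*c+y*c = (starRingEnd ℂ) (x+y+c)) (hG : Gu (x+y+c) (x*y+x*c+y*c) = 0) :
    h8 x y = 0 ∨ c^9 = bb := by
  have := Gu_fact x y c h hv
  rw [hG] at this
  have hb : bb ≠ 0 := right_ne_zero_of_mul_eq_one bC_mul
  simp [hb, sub_eq_zero] at this
  exact this

lemma h8_imp (x y : ℂ) (h : h8 x y = 0) : x^9 = y^9 := by
  have := h8_mul x y
  rw [h] at this
  linear_combination -this

lemma rot (x y c : ℂ) (h : x*y*c = 1) (hv : x*y+x*c+y*c = (starRingEnd ℂ) (x+y+c))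
    (hG : Gu (x+y+c) (x*y+x*c+y*c) = 0) : y*c*x = 1 ∧
    y*c+y*x+c*x = (starRingEnd ℂ) (y+c+x) ∧ Gu (y+c+x) (y*c+y*x+c*x) = 0 := by
  have e1 : y+c+x = x+y+c := by ring
  have e2 : y*c+y*x+c*x = x*y+x*c+y*c := by ring
  rw [e1, e2]
  exact ⟨by linear_combination h, hv, hG⟩

lemma ne_of_Gu (x y c : ℂ) (h : x*y*c = 1)
    (hv : x*y+x*c+y*c = (starRingEnd ℂ) (x+y+c)) (hG : Gu (x+y+c) (x*y+x*c+y*c) = 0) :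
    x ≠ y := by
  rintro rfl
  have hx : x ≠ 0 := by rintro rfl; simp at h
  obtain ⟨r1, r2, r3⟩ := rot _ _ _ h hv hG
  have hc : c^9 = bb := by
    rcases cond_of_Gu _ _ _ h hv hG with h1 | h1
    · exfalso
      have : h8 x x = 9 * x^8 := by unfold h8; ring
      rw [this] at h1
      simp [hx] at h1
    · exact h1
  have hb3 := bb_cube
  have hX : (x^9)^2 * bb = 1 := by
    rw [← hc]; linear_combination ((x*x*c)^8 + (x*x*c)^7 + (x*x*c)^6 + (x*x*c)^5 + (x*x*c)^4
      + (x*x*c)^3 + (x*x*c)^2 + (x*x*c) + 1) * h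
  have key : x^9 = bb := by
    rcases cond_of_Gu _ _ _ r1 r2 r3 with h1 | h1
    · rw [h8_imp _ _ h1, hc]
    · exact h1
  rw [key] at hX
  have : (2 : ℂ) = 0 := by linear_combination hb3 - hX
  norm_num at this

lemma Gu_iff (x y c : ℂ) (h : x*y*c = 1)
    (hv : x*y+x*c+y*c = (starRingEnd ℂ) (x+y+c)) :
    Gu (x+y+c) (x*y+x*c+y*c) = 0 ↔ (x ≠ y ∧ y ≠ c ∧ c ≠ x) ∧
      (x^9 = y^9 ∨ c^9 = bb) ∧ (y^9 = c^9 ∨ x^9 = bb) ∧ (c^9 = x^9 ∨ y^9 = bb) := by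
  constructor
  · intro hG
    obtain ⟨r1, r2, r3⟩ := rot _ _ _ h hv hG
    obtain ⟨s1, s2, s3⟩ := rot _ _ _ r1 r2 r3
    exact ⟨⟨ne_of_Gu _ _ _ h hv hG, ne_of_Gu _ _ _ r1 r2 r3, ne_of_Gu _ _ _ s1 s2 s3⟩,
      (cond_of_Gu _ _ _ h hv hG).imp_left (h8_imp _ _),
      (cond_of_Gu _ _ _ r1 r2 r3).imp_left (h8_imp _ _),
      (cond_of_Gu _ _ _ s1 s2 s3).imp_left (h8_imp _ _)⟩
  · rintro ⟨⟨n1, n2, n3⟩, c1, c2, c3⟩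
    have aux : ∀ x y c : ℂ, x ≠ y → (x^9 = y^9 ∨ c^9 = bb) → h8 x y * (bb * (c^9 - bb)) = 0 := by
      intro x y c hn hc
      rcases hc with hc | hc
      · have := h8_mul x y
        rw [hc, sub_self, mul_eq_zero, sub_eq_zero] at this
        rw [this.resolve_left hn, zero_mul]
      · rw [hc]; ring
    have g1 := Gu_fact x y c h hv
    have hvr : y*c+y*x+c*x = (starRingEnd ℂ) (y+c+x) := by
      rw [show y+c+x = x+y+c by ring, ← hv]; ring
    have g2 := Gu_fact y c x (by linear_combination h) hvr
    rw [show y+c+x = x+y+c by ring, show y*c+y*x+c*x = x*y+x*c+y*c by ring] at g2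
    have a1 := aux x y c n1 c1
    have a2 := aux y c x n2 c2
    have a3 : (c - x) * (starRingEnd ℂ) (Gu (x+y+c) (x*y+x*c+y*c)) = 0 := by
      linear_combination g1 - g2 - 9 * a1 + 9 * a2
    have a4 := (mul_eq_zero.mp a3).resolve_left (sub_ne_zero.mpr n3)
    rw [a4] at g1
    linear_combination g1 - 9 * a1

lemma pow54 (X Y C : ℂ) (h : X*Y*C = 1)
    (c1 : X = Y ∨ C = bb) (c2 : Y = C ∨ X = bb) (c3 : C = X ∨ Y = bb) : X^6 = 1 := by
  have hb := bb_cube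
  have hb0 : bb ≠ 0 := right_ne_zero_of_mul_eq_one bC_mul
  have hb6 : bb^6 = 1 := by linear_combination (bb^3 - 1) * hb
  have aux : X * bb * bb = 1 → X^6 = 1 := by
    intro hX
    have h1 : X = -bb := by linear_combination (-bb) * hX + X * hb
    rw [h1]; linear_combination hb6
  rcases c2 with c2 | c2
  · subst c2
    rcases c1 with c1 | c1
    · subst c1; linear_combination (X^3+1) * h
    · subst c1; exact aux h
  · rw [c2]; exact hb6

lemma exists_roots (u v : ℂ) : ∃ x y c : ℂ, x*y*c = 1 ∧ x+y+c = u ∧ x*y+x*c+y*c = v := by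
  obtain ⟨x, hx⟩ : ∃ x : ℂ, x^3 - u*x^2 + v*x - 1 = 0 := by
    have hd : (Cubic.toPoly ⟨(1:ℂ), -u, v, -1⟩).degree ≠ 0 := by
      rw [Cubic.degree_of_a_ne_zero (by simp)]; norm_num
    obtain ⟨x, hx⟩ := IsAlgClosed.exists_root _ hd
    refine ⟨x, ?_⟩
    simp [Cubic.toPoly, Polynomial.IsRoot] at hx
    linear_combination hx
  have hx0 : x ≠ 0 := by rintro rfl; simp at hx
  obtain ⟨s, hs⟩ := IsAlgClosed.exists_pow_nat_eq ((u-x)^2 - 4*x⁻¹) (n := 2) (by norm_num)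
  have hi : x * x⁻¹ = 1 := mul_inv_cancel₀ hx0
  have hp : ((u-x+s)/2) * ((u-x-s)/2) = x⁻¹ := by linear_combination -hs/4
  refine ⟨x, (u-x+s)/2, (u-x-s)/2, by rw [mul_assoc, hp, hi], by ring, ?_⟩
  have : x * (x*((u-x+s)/2)+x*((u-x-s)/2)+((u-x+s)/2)*((u-x-s)/2)) = x * v := by
    rw [hp]; linear_combination hi - hx
  exact mul_left_cancel₀ hx0 this

/-! ### The index set -/

def Cond (a b c : ℕ) : Prop := (a + b + c) % 54 = 0 ∧ (a % 6 = b % 6 ∨ c % 6 = 1) ∧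
  (b % 6 = c % 6 ∨ a % 6 = 1) ∧ (c % 6 = a % 6 ∨ b % 6 = 1)

instance (a b c : ℕ) : Decidable (Cond a b c) := by unfold Cond; infer_instance

def third (k : ℕ × ℕ) : ℕ := (108 - k.1 - k.2) % 54

@[irreducible] def K : Finset (ℕ × ℕ) := (Finset.range 54 ×ˢ Finset.range 54).filter
  fun k => k.1 < k.2 ∧ k.2 < third k ∧ Cond k.1 k.2 (third k)

def val (k : ℕ × ℕ) : ℤ :=
  if k.1 % 6 = k.2 % 6 ∧ k.2 % 6 = third k % 6 then (if k.1 % 6 = 4 then 8 else -1) else 0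

def su (a b c : ℕ) : ℂ := zt^a + zt^b + zt^c

def pt (k : ℕ × ℕ) : ℝ × ℝ := ((su k.1 k.2 (third k)).re, (su k.1 k.2 (third k)).im)

lemma prod_zt (a b c : ℕ) (h : (a+b+c) % 54 = 0) : zt^a * zt^b * zt^c = 1 := by
  rw [← pow_add, ← pow_add, ← pow_zero zt, zt_pow_eq]; exact h

lemma conj_su (a b c : ℕ) (h : (a+b+c) % 54 = 0) :
    zt^a * zt^b + zt^a * zt^c + zt^b * zt^c = (starRingEnd ℂ) (zt^a + zt^b + zt^c) := by
  have hp := prod_zt a b c h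
  rw [map_add, map_add]
  have ha := conj_zt_mul a
  have hb := conj_zt_mul b
  have hc := conj_zt_mul c
  set A := (starRingEnd ℂ) (zt^a)
  set B := (starRingEnd ℂ) (zt^b)
  set C := (starRingEnd ℂ) (zt^c)
  linear_combination (A + B + C) * hp - (zt^b*zt^c) * ha - (zt^a*zt^c) * hb - (zt^a*zt^b) * hc

lemma Gu_zt (a b c : ℕ) (ha : a < 54) (hb : b < 54) (hc : c < 54) (h : (a+b+c) % 54 = 0) :
    Gu (zt^a + zt^b + zt^c) (zt^a * zt^b + zt^a * zt^c + zt^b * zt^c) = 0 ↔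
      (a ≠ b ∧ b ≠ c ∧ c ≠ a) ∧ Cond a b c := by
  rw [Gu_iff _ _ _ (prod_zt a b c h) (conj_su a b c h)]
  simp only [ne_eq, bb, ← pow_mul, zt_pow_eq, Cond]
  omega

lemma K_mem (k : ℕ × ℕ) (hk : k ∈ K) : k.1 < k.2 ∧ k.2 < third k ∧ third k < 54 ∧
    Cond k.1 k.2 (third k) := by
  simp only [K, Finset.mem_filter, Finset.mem_product, Finset.mem_range] at hk
  exact ⟨hk.2.1, hk.2.2.1, Nat.mod_lt _ (by norm_num), hk.2.2.2⟩

lemma pt_cplx (k : ℕ × ℕ) : su k.1 k.2 (third k) = ((pt k).1 : ℂ) + ((pt k).2 : ℂ) * Complex.I := by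
  simp [pt, Complex.re_add_im]

lemma pt_crit (k : ℕ × ℕ) (hk : k ∈ K) : pdx J9 (pt k) = 0 ∧ pdy J9 (pt k) = 0 := by
  obtain ⟨h1, h2, h3, h4⟩ := K_mem k hk
  have hs := h4.1
  rw [crit_iff_Gu (pt k) _ _ (pt_cplx k) (conj_su _ _ _ hs)]
  exact (Gu_zt _ _ _ (by omega) (by omega) h3 hs).2 ⟨by omega, h4⟩

lemma mem_K_of (p : ℝ × ℝ) (a b c : ℕ) (h1 : a < b) (h2 : b < c) (h3 : c < 54) (h4 : Cond a b c)
    (hp : zt^a + zt^b + zt^c = (p.1 : ℂ) + (p.2 : ℂ) * Complex.I) : ∃ k ∈ K, pt k = p := by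
  have ht : third (a, b) = c := by
    have := h4.1
    simp only [third]; omega
  refine ⟨(a, b), ?_, ?_⟩
  · simp only [K, Finset.mem_filter, Finset.mem_product, Finset.mem_range, ht]
    exact ⟨by omega, h1, h2, h4⟩
  · have := pt_cplx (a, b)
    rw [ht, su, hp] at this
    have hr := congrArg Complex.re this
    have hi := congrArg Complex.im this
    simp at hr hi
    exact Prod.ext hr.symm hi.symm

lemma crit_pt (p : ℝ × ℝ) (hp : pdx J9 p = 0 ∧ pdy J9 p = 0) : ∃ k ∈ K, pt k = p := by
  obtain ⟨x, y, c, h, hu, hv⟩ := exists_roots ((p.1 : ℂ) + (p.2 : ℂ) * Complex.I)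
    ((starRingEnd ℂ) ((p.1 : ℂ) + (p.2 : ℂ) * Complex.I))
  rw [crit_iff_Gu p _ (x*y+x*c+y*c) hu (by rw [hv, hu])] at hp
  have hvb : x*y+x*c+y*c = (starRingEnd ℂ) (x+y+c) := by rw [hv, hu]
  have hpb := hp
  rw [Gu_iff x y c h hvb] at hpb
  obtain ⟨-, c1, c2, c3⟩ := hpb
  have h9 : x^9*y^9*c^9 = 1 := by rw [← mul_pow, ← mul_pow, h, one_pow]
  have hx : x^54 = 1 := by rw [← pow54 _ _ _ h9 c1 c2 c3]; ring
  have hy : y^54 = 1 := by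
    rw [← pow54 (y^9) (c^9) (x^9) (by linear_combination h9) c2 c3 c1]; ring
  have hc : c^54 = 1 := by
    rw [← pow54 (c^9) (x^9) (y^9) (by linear_combination h9) c3 c1 c2]; ring
  obtain ⟨i, hi, rfl⟩ := zt_prim.eq_pow_of_pow_eq_one hx
  obtain ⟨j, hj, rfl⟩ := zt_prim.eq_pow_of_pow_eq_one hy
  obtain ⟨k, hk, rfl⟩ := zt_prim.eq_pow_of_pow_eq_one hc
  have hs : (i+j+k) % 54 = 0 := by
    rw [← pow_add, ← pow_add, ← pow_zero zt, zt_pow_eq] at h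
    exact h
  rw [Gu_zt i j k hi hj hk hs] at hp
  obtain ⟨⟨n1, n2, n3⟩, hC⟩ := hp
  have perm1 : Cond j k i := by unfold Cond at *; omega
  have perm2 : Cond k i j := by unfold Cond at *; omega
  have perm3 : Cond j i k := by unfold Cond at *; omega
  have perm4 : Cond i k j := by unfold Cond at *; omega
  have perm5 : Cond k j i := by unfold Cond at *; omega
  rcases lt_or_gt_of_ne n1 with l1 | l1 <;> rcases lt_or_gt_of_ne n2 with l2 | l2 <;>
    rcases lt_or_gt_of_ne n3 with l3 | l3
  · omega
  · exact mem_K_of p i j k l1 l2 hk hC hu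
  · exact mem_K_of p k i j l3 l1 hj perm2 (by rw [← hu]; ring)
  · exact mem_K_of p i k j l3 l2 hj perm4 (by rw [← hu]; ring)
  · exact mem_K_of p j k i l2 l3 hi perm1 (by rw [← hu]; ring)
  · exact mem_K_of p j i k l1 l3 hk perm3 (by rw [← hu]; ring)
  · exact mem_K_of p k j i l2 l1 hi perm5 (by rw [← hu]; ring)
  · omega

lemma pt_inj : Set.InjOn pt (K : Set (ℕ × ℕ)) := by
  intro k hk l hl hkl
  obtain ⟨h1, h2, h3, h4⟩ := K_mem k hk
  obtain ⟨g1, g2, g3, g4⟩ := K_mem l hl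
  have hs : su k.1 k.2 (third k) = su l.1 l.2 (third l) := by rw [pt_cplx, pt_cplx, hkl]
  have e2 := conj_su _ _ _ h4.1
  have e2b := conj_su _ _ _ g4.1
  have e3 := prod_zt _ _ _ h4.1
  have e3b := prod_zt _ _ _ g4.1
  simp only [su] at hs
  rw [hs, ← e2b] at e2
  have key : ∀ n < 54, (zt^n - zt^l.1) * (zt^n - zt^l.2) * (zt^n - zt^(third l)) = 0 →
      n = l.1 ∨ n = l.2 ∨ n = third l := by
    intro n hn h
    simp only [mul_eq_zero, sub_eq_zero, zt_pow_eq] at h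
    omega
  have gen : ∀ z : ℂ, (z - zt^l.1) * (z - zt^l.2) * (z - zt^(third l)) =
      (z - zt^k.1) * (z - zt^k.2) * (z - zt^(third k)) := by
    intro z
    linear_combination z^2 * hs - z * e2 + e3 - e3b
  have k1 := key k.1 (by omega) (by rw [gen]; ring)
  have k2 := key k.2 (by omega) (by rw [gen]; ring)
  have k3 := key (third k) (by omega) (by rw [gen]; ring)
  exact Prod.ext (by omega) (by omega)

lemma cases_aux (a b c : ℕ) (m1 : a < 6) (m2 : b < 6) (m3 : c < 6) (hs : (a + b + c) % 6 = 0)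
    (d1 : a = b ∨ c = 1) (d2 : b = c ∨ a = 1) (d3 : c = a ∨ b = 1) :
    (a = 0 ∧ b = 0 ∧ c = 0) ∨ (a = 2 ∧ b = 2 ∧ c = 2) ∨ (a = 4 ∧ b = 4 ∧ c = 4) ∨
      (a = 1 ∧ b = 1 ∧ c = 4) ∨ (a = 1 ∧ b = 4 ∧ c = 1) ∨ (a = 4 ∧ b = 1 ∧ c = 1) := by
  interval_cases a <;> interval_cases b <;> simp at d1 d2 d3 <;> try subst c
  all_goals (first | (interval_cases c <;> simp at *) | simp at *)

lemma val_aux (a b c : ℕ) (m1 : a < 6) (m2 : b < 6) (m3 : c < 6) (hs : (a + b + c) % 6 = 0)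
    (d1 : a = b ∨ c = 1) (d2 : b = c ∨ a = 1) (d3 : c = a ∨ b = 1) :
    2 - ((1 - bb) * (bb^a + bb^b + bb^c) + bb * (bb^b * bb^c + bb^a * bb^c + bb^a * bb^b))
      = (((if a = b ∧ b = c then (if a = 4 then 8 else -1) else 0 : ℤ)) : ℂ) := by
  have hb2 : bb^2 = bb - 1 := by linear_combination -bC_mul + bb * bC_add
  have hb4 : bb^4 = -bb := by linear_combination bb * bb_cube
  rcases cases_aux a b c m1 m2 m3 hs d1 d2 d3 with ⟨rfl, rfl, rfl⟩ | ⟨rfl, rfl, rfl⟩ |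
      ⟨rfl, rfl, rfl⟩ | ⟨rfl, rfl, rfl⟩ | ⟨rfl, rfl, rfl⟩ | ⟨rfl, rfl, rfl⟩
  · norm_num
    ring
  · norm_num [hb2]
    linear_combination (-3 * bb + 6) * hb2
  · norm_num [hb4]
    linear_combination (-3 * bb - 6) * hb2
  · norm_num [hb4]
    linear_combination (bb + 2) * hb2
  · norm_num [hb4]
    linear_combination (bb + 2) * hb2
  · norm_num [hb4]
    linear_combination (bb + 2) * hb2

lemma J9_pt (k : ℕ × ℕ) (hk : k ∈ K) : J9 (pt k) = val k := by
  obtain ⟨h1, h2, h3, h4⟩ := K_mem k hk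
  have hJ := J9_eq (pt k) _ _ (pt_cplx k) (conj_su _ _ _ h4.1)
  have e3 := prod_zt _ _ _ h4.1
  simp only [su] at hJ
  have q2 := p9_sum (zt^k.2*zt^third k) (zt^k.1*zt^third k) (zt^k.1*zt^k.2)
    (by linear_combination (zt^k.1*zt^k.2*zt^third k+1)*e3)
  rw [show zt^k.2*zt^third k + zt^k.1*zt^third k + zt^k.1*zt^k.2
      = zt^k.1*zt^k.2 + zt^k.1*zt^third k + zt^k.2*zt^third k by ring,
    show zt^k.2*zt^third k*(zt^k.1*zt^third k) + zt^k.2*zt^third k*(zt^k.1*zt^k.2)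
      + zt^k.1*zt^third k*(zt^k.1*zt^k.2) = zt^k.1 + zt^k.2 + zt^third k by
      linear_combination (zt^k.1 + zt^k.2 + zt^third k) * e3] at q2
  rw [p9_sum _ _ _ e3, q2] at hJ
  have hb3 := bb_cube
  have hb2 : bb^2 = bb - 1 := by linear_combination -bC_mul + bb * bC_add
  have hbC : bC = 1 - bb := by linear_combination bC_add
  -- ninth powers depend only on the exponent mod 6
  have red : ∀ n : ℕ, (zt^n)^9 = bb^(n % 6) := by
    intro n
    rw [bb, ← pow_mul, ← pow_mul, zt_pow_eq]; omega
  simp only [mul_pow, red] at hJ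
  have main : (J9 (pt k) : ℂ) = ((val k : ℤ) : ℂ) := by
    rw [hJ, hbC]
    unfold val
    unfold Cond at h4
    have m1 : k.1 % 6 < 6 := Nat.mod_lt _ (by norm_num)
    have m2 : k.2 % 6 < 6 := Nat.mod_lt _ (by norm_num)
    have m3 : third k % 6 < 6 := Nat.mod_lt _ (by norm_num)
    have hsum : (k.1 % 6 + k.2 % 6 + third k % 6) % 6 = 0 := by omega
    obtain ⟨-, d1, d2, d3⟩ := h4
    generalize k.1 % 6 = a at *
    generalize k.2 % 6 = b at *
    generalize third k % 6 = c at *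
    exact val_aux a b c m1 m2 m3 hsum d1 d2 d3
  exact_mod_cast main

lemma crit_set (q : ℝ × ℝ → Prop) (r : ℕ × ℕ → Prop) [DecidablePred r]
    (h : ∀ k ∈ K, q (pt k) ↔ r k) :
    {p : ℝ × ℝ | (pdx J9 p = 0 ∧ pdy J9 p = 0) ∧ q p} = pt '' (K.filter r : Finset (ℕ × ℕ)) := by
  ext p
  simp only [Set.mem_ofPred_eq, Set.mem_image, Finset.coe_filter]
  constructor
  · rintro ⟨hp, hq⟩
    obtain ⟨k, hk, rfl⟩ := crit_pt p hp
    exact ⟨k, ⟨hk, (h k hk).1 hq⟩, rfl⟩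
  · rintro ⟨k, ⟨hk, hr⟩, rfl⟩
    exact ⟨pt_crit k hk, (h k hk).2 hr⟩

lemma crit_ncard (q : ℝ × ℝ → Prop) (r : ℕ × ℕ → Prop) [DecidablePred r]
    (h : ∀ k ∈ K, q (pt k) ↔ r k) :
    {p : ℝ × ℝ | (pdx J9 p = 0 ∧ pdy J9 p = 0) ∧ q p}.ncard = (K.filter r).card := by
  rw [crit_set q r h, Set.InjOn.ncard_image, Set.ncard_coe_finset]
  exact pt_inj.mono (by intro k hk; simp at hk; exact hk.1)

/-- `J9` has exactly 64 critical points; every critical value is `0`, `-1` or `8`;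
exactly 36 critical points have value `0`, exactly 19 have value `-1` and exactly 9
have value `8`. -/
theorem stmt :
    {p : ℝ × ℝ | pdx J9 p = 0 ∧ pdy J9 p = 0}.Finite ∧
    {p : ℝ × ℝ | pdx J9 p = 0 ∧ pdy J9 p = 0}.ncard = 64 ∧
    (∀ p : ℝ × ℝ, pdx J9 p = 0 ∧ pdy J9 p = 0 →
      J9 p = 0 ∨ J9 p = -1 ∨ J9 p = 8) ∧
    {p : ℝ × ℝ | (pdx J9 p = 0 ∧ pdy J9 p = 0) ∧ J9 p = 0}.ncard = 36 ∧
    {p : ℝ × ℝ | (pdx J9 p = 0 ∧ pdy J9 p = 0) ∧ J9 p = -1}.ncard = 19 ∧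
    {p : ℝ × ℝ | (pdx J9 p = 0 ∧ pdy J9 p = 0) ∧ J9 p = 8}.ncard = 9 := by
  have hall : {p : ℝ × ℝ | pdx J9 p = 0 ∧ pdy J9 p = 0} =
      {p : ℝ × ℝ | (pdx J9 p = 0 ∧ pdy J9 p = 0) ∧ True} := by simp
  refine ⟨?_, ?_, ?_, ?_, ?_, ?_⟩
  · rw [hall, crit_set (fun _ => True) (fun _ => True) (by simp)]
    exact (Finset.finite_toSet _).image _
  · rw [hall, crit_ncard (fun _ => True) (fun _ => True) (by simp)]
    decide +kernel
  · intro p hp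
    obtain ⟨k, hk, rfl⟩ := crit_pt p hp
    rw [J9_pt k hk]
    unfold val
    split_ifs <;> simp
  · rw [crit_ncard (fun p => J9 p = 0) (fun k => val k = 0)
      (by intro k hk; rw [J9_pt k hk]; norm_cast)]
    decide +kernel
  · rw [crit_ncard (fun p => J9 p = -1) (fun k => val k = -1)
      (by intro k hk; rw [J9_pt k hk]; norm_cast)]
    decide +kernel
  · rw [crit_ncard (fun p => J9 p = 8) (fun k => val k = 8)
      (by intro k hk; rw [J9_pt k hk]; norm_cast)]
    decide +kernel
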